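/- Let A, B be symmetric (0,2)-tensors on V. Then the components of the Riemann-type tensor A ∧ B with respect to u are given by: (A ∧ B)^⊥ = A^⊥ B^∥ + B^⊥ A^∥ − 2 A^{⊥∥} ⊗_s B^{⊥∥}; (A ∧ B)^{⊥∥}_{βμν} = 2 A^{⊥∥}_{[μ} B^∥_{ν]β} + 2 B^{⊥∥}_{[μ} A^∥_{ν]β}; and (A ∧ B)^{∥u} = A^∥ ∧ B^∥ + (ε/(n−3)) (A^⊥ B^∥ + B^⊥ A^∥ − 2 A^{⊥∥} ⊗_s B^{⊥∥}) ∧ γ; consequently A ∧ B = (A ∧ B)^{∥u} + ε (u ⊛ (A ∧ B)^{⊥∥}) + (A ∧ B)^⊥ ∧ η. -/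

import Mathlib

open scoped BigOperators

noncomputable section

namespace Decomp

abbrev Vec (n : ℕ) := Fin n → ℝ
abbrev Ten2 (n : ℕ) := Fin n → Fin n → ℝ
abbrev Ten3 (n : ℕ) := Fin n → Fin n → Fin n → ℝ
abbrev Ten4 (n : ℕ) := Fin n → Fin n → Fin n → Fin n → ℝ

variable {n : ℕ}

/-- A (0,4)-tensor with the algebraic symmetries of a Riemann tensor. -/
def IsRiemannType (T : Ten4 n) : Prop :=
  (∀ α β μ ν, T α β μ ν = - T α β ν μ) ∧
  (∀ α β μ ν, T α β μ ν = - T β α μ ν) ∧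
  (∀ α β μ ν, T α β μ ν = T μ ν α β) ∧
  (∀ α β μ ν, T α β μ ν + T α μ ν β + T α ν β μ = 0)

/-- A (0,3)-tensor antisymmetric in the last two indices with vanishing cyclic sum. -/
def IsLambda12 (F : Ten3 n) : Prop :=
  (∀ α μ ν, F α μ ν = - F α ν μ) ∧
  (∀ α μ ν, F α μ ν + F μ ν α + F ν α μ = 0)

def IsSym2 (S : Ten2 n) : Prop := ∀ α β, S α β = S β α

/-- Ricci-type trace of a (0,4)-tensor (first and third indices, using the inverse metric). -/
def RicT (ginv : Ten2 n) (T : Ten4 n) : Ten2 n :=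
  fun β ν => ∑ α, ∑ μ, ginv α μ * T α β μ ν

/-- Scalar-type trace. -/
def ScalT (ginv : Ten2 n) (T : Ten4 n) : ℝ :=
  ∑ β, ∑ ν, ginv β ν * RicT ginv T β ν

/-- Weyl-type: Riemann-type and trace-free in the first and third indices. -/
def IsWeylType (ginv : Ten2 n) (T : Ten4 n) : Prop :=
  IsRiemannType T ∧ ∀ β ν, RicT ginv T β ν = 0

/-- Kulkarni–Nomizu product. -/
def KN (A B : Ten2 n) : Ten4 n := fun α β μ ν =>
  A α μ * B β ν - A α ν * B β μ - A β μ * B α ν + A β ν * B α μ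

/-- (u ⊛ F) for a one-form w and F ∈ Λ^{(1,2)}. -/
def circ (w : Vec n) (F : Ten3 n) : Ten4 n := fun α β μ ν =>
  w α * F β μ ν - w β * F α μ ν + w μ * F ν α β - w ν * F μ α β

/-- Lower an index with the metric. -/
def lower (g : Ten2 n) (u : Vec n) : Vec n := fun α => ∑ β, g α β * u β

/-- Projector orthogonal to `u`, both indices covariant: γ_{αβ} = g_{αβ} − ε u_α u_β. -/
def gam (g : Ten2 n) (ε : ℝ) (u : Vec n) : Ten2 n := fun α β =>
  g α β - ε * lower g u α * lower g u β

/-- Mixed projector γ^κ_μ = δ^κ_μ − ε u^κ u_μ. -/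
def gamMix (g : Ten2 n) (ε : ℝ) (u : Vec n) : Ten2 n := fun κ μ =>
  (if κ = μ then (1 : ℝ) else 0) - ε * u κ * lower g u μ

/-- Contravariant projector γ^{αβ} = g^{αβ} − ε u^α u^β. -/
def gamUp (ginv : Ten2 n) (ε : ℝ) (u : Vec n) : Ten2 n := fun α β =>
  ginv α β - ε * u α * u β

/-- η := u⊗u − (ε/(n−3)) γ. -/
def eta (g : Ten2 n) (ε : ℝ) (u : Vec n) : Ten2 n := fun α β =>
  lower g u α * lower g u β - (ε / ((n : ℝ) - 3)) * gam g ε u α β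

/-- T^⊥_{βν} := u^α u^μ T_{αβμν}. -/
def perp (u : Vec n) (T : Ten4 n) : Ten2 n := fun β ν =>
  ∑ α, ∑ μ, u α * u μ * T α β μ ν

/-- T^{⊥∥}_{βμν} := u^α γ^κ_μ γ^σ_ν T_{αβκσ}. -/
def perppar (g : Ten2 n) (ε : ℝ) (u : Vec n) (T : Ten4 n) : Ten3 n := fun β μ ν =>
  ∑ α, ∑ κ, ∑ σ, u α * gamMix g ε u κ μ * gamMix g ε u σ ν * T α β κ σ

/-- T^∥ : projection of T with γ in all four indices. -/
def par4 (g : Ten2 n) (ε : ℝ) (u : Vec n) (T : Ten4 n) : Ten4 n := fun α β μ ν =>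
  ∑ ρ, ∑ σ, ∑ κ, ∑ δ,
    gamMix g ε u ρ α * gamMix g ε u σ β * gamMix g ε u κ μ * gamMix g ε u δ ν * T ρ σ κ δ

/-- T^{∥u} := T^∥ + (ε/(n−3)) T^⊥ ∧ γ. -/
def parU (g : Ten2 n) (ε : ℝ) (u : Vec n) (T : Ten4 n) : Ten4 n := fun α β μ ν =>
  par4 g ε u T α β μ ν + (ε / ((n : ℝ) - 3)) * KN (perp u T) (gam g ε u) α β μ ν

/-- Complete orthogonality to `u` for (0,2)-tensors. -/
def Orth2 (u : Vec n) (S : Ten2 n) : Prop :=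
  (∀ β, (∑ α, u α * S α β) = 0) ∧ (∀ β, (∑ α, u α * S β α) = 0)

/-- Complete orthogonality to `u` for (0,3)-tensors. -/
def Orth3 (u : Vec n) (F : Ten3 n) : Prop :=
  (∀ μ ν, (∑ α, u α * F α μ ν) = 0) ∧ (∀ μ ν, (∑ α, u α * F μ α ν) = 0) ∧
    (∀ μ ν, (∑ α, u α * F μ ν α) = 0)

/-- Complete orthogonality to `u` for (0,4)-tensors. -/
def Orth4 (u : Vec n) (T : Ten4 n) : Prop :=
  (∀ β μ ν, (∑ α, u α * T α β μ ν) = 0) ∧ (∀ β μ ν, (∑ α, u α * T β α μ ν) = 0) ∧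
    (∀ β μ ν, (∑ α, u α * T β μ α ν) = 0) ∧ (∀ β μ ν, (∑ α, u α * T β μ ν α) = 0)

/-- tr_γ of a (0,2)-tensor. -/
def trGam (ginv : Ten2 n) (ε : ℝ) (u : Vec n) (S : Ten2 n) : ℝ :=
  ∑ α, ∑ β, gamUp ginv ε u α β * S α β

/-- Schouten-type tensor of a (0,4)-tensor. -/
def SchT (g ginv : Ten2 n) (T : Ten4 n) : Ten2 n := fun β ν =>
  (1 / ((n : ℝ) - 2)) * (RicT ginv T β ν - ScalT ginv T / (2 * ((n : ℝ) - 1)) * g β ν)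

/-- Weyl-type part of a (0,4)-tensor: Weyl(T) := T − Sch(T) ∧ g. -/
def WeylT (g ginv : Ten2 n) (T : Ten4 n) : Ten4 n := fun α β μ ν =>
  T α β μ ν - KN (SchT g ginv T) g α β μ ν

/-- Sch_u for Riemann-type tensors completely orthogonal to u. -/
def SchU (g ginv : Ten2 n) (ε : ℝ) (u : Vec n) (P : Ten4 n) : Ten2 n := fun β ν =>
  (1 / ((n : ℝ) - 3)) * (RicT ginv P β ν - ScalT ginv P / (2 * ((n : ℝ) - 2)) * gam g ε u β ν)

/-- Weyl_u for Riemann-type tensors completely orthogonal to u. -/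
def WeylU (g ginv : Ten2 n) (ε : ℝ) (u : Vec n) (P : Ten4 n) : Ten4 n := fun α β μ ν =>
  P α β μ ν - KN (SchU g ginv ε u P) (gam g ε u) α β μ ν

/-- Z_tr := tr_γ T^⊥. -/
def Ztr (ginv : Ten2 n) (ε : ℝ) (u : Vec n) (T : Ten4 n) : ℝ :=
  trGam ginv ε u (perp u T)

/-- γ-trace-free part of an orthogonal symmetric (0,2)-tensor. -/
def hat2 (g ginv : Ten2 n) (ε : ℝ) (u : Vec n) (S : Ten2 n) : Ten2 n := fun β ν =>
  S β ν - trGam ginv ε u S / ((n : ℝ) - 1) * gam g ε u β ν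

/-- T̂^⊥ := T^⊥ − (Z_tr/(n−1)) γ. -/
def hatPerp (g ginv : Ten2 n) (ε : ℝ) (u : Vec n) (T : Ten4 n) : Ten2 n :=
  hat2 g ginv ε u (perp u T)

/-- (V_tr)_μ := γ^{αβ} T^{⊥∥}_{αβμ}. -/
def Vtr (g ginv : Ten2 n) (ε : ℝ) (u : Vec n) (T : Ten4 n) : Vec n := fun μ =>
  ∑ α, ∑ β, gamUp ginv ε u α β * perppar g ε u T α β μ

/-- T̂^{⊥∥}_{αβμ} := T^{⊥∥}_{αβμ} + (1/(n−2))(−γ_{αβ}(V_tr)_μ + γ_{αμ}(V_tr)_β). -/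
def hatPerppar (g ginv : Ten2 n) (ε : ℝ) (u : Vec n) (T : Ten4 n) : Ten3 n := fun α β μ =>
  perppar g ε u T α β μ + (1 / ((n : ℝ) - 2)) *
    (- gam g ε u α β * Vtr g ginv ε u T μ + gam g ε u α μ * Vtr g ginv ε u T β)

/-- S^∥_{βν} := γ^ρ_β γ^κ_ν S_{ρκ}. -/
def s2par (g : Ten2 n) (ε : ℝ) (u : Vec n) (S : Ten2 n) : Ten2 n := fun β ν =>
  ∑ ρ, ∑ κ, gamMix g ε u ρ β * gamMix g ε u κ ν * S ρ κ

/-- S^{⊥∥}_β := γ^ρ_β u^κ S_{ρκ}. -/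
def s2perppar (g : Ten2 n) (ε : ℝ) (u : Vec n) (S : Ten2 n) : Vec n := fun β =>
  ∑ ρ, ∑ κ, gamMix g ε u ρ β * u κ * S ρ κ

/-- S^⊥ := u^ρ u^κ S_{ρκ}. -/
def s2perp (u : Vec n) (S : Ten2 n) : ℝ := ∑ ρ, ∑ κ, u ρ * u κ * S ρ κ

/-- σ^{(2)}_{βν} := σ_{βρ} σ^ρ{}_ν. -/
def sq (ginv : Ten2 n) (σ : Ten2 n) : Ten2 n := fun β ν =>
  ∑ ρ, ∑ κ, σ β ρ * ginv ρ κ * σ κ ν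

/-- Mixed projector h^μ_{μ'} = γ^μ_{μ'} + ε y^μ y_{μ'} orthogonal to span{u,y}. -/
def hMix (g : Ten2 n) (ε : ℝ) (u y : Vec n) : Ten2 n := fun μ μ' =>
  gamMix g ε u μ μ' + ε * y μ * lower g y μ'

/-- Covariant projector h_{αβ} = γ_{αβ} + ε y_α y_β. -/
def hCov (g : Ten2 n) (ε : ℝ) (u y : Vec n) : Ten2 n := fun α β =>
  gam g ε u α β + ε * lower g y α * lower g y β

/-- g is a symmetric nondegenerate bilinear form with (symmetric) inverse ginv. -/
def GoodMetric (g ginv : Ten2 n) : Prop :=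
  (∀ α β, g α β = g β α) ∧ (∀ α β, ginv α β = ginv β α) ∧
    (∀ α β, (∑ μ, ginv α μ * g μ β) = if α = β then (1 : ℝ) else 0) ∧
    (∀ α β, (∑ μ, g α μ * ginv μ β) = if α = β then (1 : ℝ) else 0)

/-- u is a unit vector with g(u,u) = ε ∈ {−1,1}. -/
def UnitVec (g : Ten2 n) (ε : ℝ) (u : Vec n) : Prop :=
  (ε = 1 ∨ ε = -1) ∧ (∑ α, ∑ β, g α β * u α * u β) = ε

/-- The vector `S_{βκ} u^κ`. -/
def contr (u : Vec n) (S : Ten2 n) : Vec n := fun β => ∑ κ, u κ * S β κ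

/-- The scalar `p^ρ q^κ S_{ρκ}`. -/
def bil (p q : Vec n) (S : Ten2 n) : ℝ := ∑ ρ, ∑ κ, p ρ * q κ * S ρ κ

lemma bil_eq_sum_mul_contr (p q : Vec n) (S : Ten2 n) :
    bil p q S = ∑ ρ, p ρ * contr q S ρ := by
  simp only [bil, contr, Finset.mul_sum, mul_assoc]

lemma bil_comm {S : Ten2 n} (hS : IsSym2 S) (p q : Vec n) : bil p q S = bil q p S := by
  unfold bil
  rw [Finset.sum_comm]
  refine Finset.sum_congr rfl fun ρ _ => Finset.sum_congr rfl fun κ _ => ?_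
  rw [hS κ ρ]
  ring

lemma sum_gamMix_mul (g : Ten2 n) (ε : ℝ) (u : Vec n) (f : Vec n) (β : Fin n) :
    ∑ ρ, gamMix g ε u ρ β * f ρ = f β - ε * lower g u β * ∑ ρ, u ρ * f ρ := by
  simp only [gamMix, sub_mul, Finset.sum_sub_distrib, ite_mul, one_mul, zero_mul,
    Finset.sum_ite_eq', Finset.mem_univ, if_true, Finset.mul_sum]
  congr 1
  exact Finset.sum_congr rfl fun ρ _ => by ring

lemma contr_gamMix (g : Ten2 n) (ε : ℝ) (u : Vec n) (S : Ten2 n) (β ν : Fin n) :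
    contr (fun κ => gamMix g ε u κ ν) S β = S β ν - ε * lower g u ν * contr u S β :=
  sum_gamMix_mul g ε u (S β) ν

lemma s2perp_eq_bil (u : Vec n) (S : Ten2 n) : s2perp u S = bil u u S := rfl

lemma s2perppar_eq_bil (g : Ten2 n) (ε : ℝ) (u : Vec n) (S : Ten2 n) (β : Fin n) :
    s2perppar g ε u S β = bil (fun ρ => gamMix g ε u ρ β) u S := rfl

lemma s2par_eq_bil (g : Ten2 n) (ε : ℝ) (u : Vec n) (S : Ten2 n) (β ν : Fin n) :
    s2par g ε u S β ν = bil (fun ρ => gamMix g ε u ρ β) (fun κ => gamMix g ε u κ ν) S := rfl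

lemma s2perppar_eq (g : Ten2 n) (ε : ℝ) (u : Vec n) (S : Ten2 n) (β : Fin n) :
    s2perppar g ε u S β = contr u S β - ε * lower g u β * s2perp u S := by
  rw [s2perppar_eq_bil, s2perp_eq_bil, bil_eq_sum_mul_contr, bil_eq_sum_mul_contr,
    sum_gamMix_mul]

lemma s2par_eq (g : Ten2 n) (ε : ℝ) (u : Vec n) {S : Ten2 n} (hS : IsSym2 S) (β ν : Fin n) :
    s2par g ε u S β ν = S β ν - ε * lower g u ν * contr u S β
      - ε * lower g u β * s2perppar g ε u S ν := by
  rw [s2par_eq_bil, s2perppar_eq_bil, bil_comm hS _ u, bil_eq_sum_mul_contr,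
    bil_eq_sum_mul_contr, sum_gamMix_mul, contr_gamMix]

/-- Contraction of a Kulkarni–Nomizu product with four vectors. -/
lemma sum_mul_KN (p q r s : Vec n) (A B : Ten2 n) :
    ∑ ρ, ∑ σ, ∑ κ, ∑ δ, p ρ * q σ * r κ * s δ * KN A B ρ σ κ δ =
      bil p r A * bil q s B - bil p s A * bil q r B
        - bil q r A * bil p s B + bil q s A * bil p r B := by
  have parallel : ∀ F G : Ten2 n, (∑ ρ, ∑ κ, F ρ κ) * (∑ σ, ∑ δ, G σ δ) =
      ∑ ρ, ∑ σ, ∑ κ, ∑ δ, F ρ κ * G σ δ := fun F G => by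
    simp only [Finset.sum_mul_sum]
  have crossed : ∀ F G : Ten2 n, (∑ ρ, ∑ δ, F ρ δ) * (∑ σ, ∑ κ, G σ κ) =
      ∑ ρ, ∑ σ, ∑ κ, ∑ δ, F ρ δ * G σ κ := fun F G => by
    rw [parallel]
    exact Finset.sum_congr rfl fun ρ _ => Finset.sum_congr rfl fun σ _ => Finset.sum_comm
  rw [mul_comm (bil q r A), mul_comm (bil q s A)]
  simp only [bil]
  rw [parallel, crossed, crossed, parallel]
  simp only [← Finset.sum_sub_distrib, ← Finset.sum_add_distrib]
  refine Finset.sum_congr rfl fun ρ _ => Finset.sum_congr rfl fun σ _ =>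
    Finset.sum_congr rfl fun κ _ => Finset.sum_congr rfl fun δ _ => ?_
  simp only [KN]
  ring

lemma bil_single_left (q : Vec n) (S : Ten2 n) (β : Fin n) :
    bil (Pi.single β 1) q S = contr q S β := by
  simp [bil_eq_sum_mul_contr, Pi.single_apply]

lemma contr_single (S : Ten2 n) (β ν : Fin n) : contr (Pi.single ν 1) S β = S β ν := by
  simp [contr, Pi.single_apply]

lemma perp_eq_sum_single (u : Vec n) (T : Ten4 n) (β ν : Fin n) :
    perp u T β ν = ∑ ρ, ∑ σ, ∑ κ, ∑ δ,
      u ρ * (Pi.single β 1 : Vec n) σ * u κ * (Pi.single ν 1 : Vec n) δ * T ρ σ κ δ := by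
  simp [perp, Pi.single_apply]

lemma perppar_eq_sum_single (g : Ten2 n) (ε : ℝ) (u : Vec n) (T : Ten4 n) (β μ ν : Fin n) :
    perppar g ε u T β μ ν = ∑ ρ, ∑ σ, ∑ κ, ∑ δ,
      u ρ * (Pi.single β 1 : Vec n) σ * gamMix g ε u κ μ * gamMix g ε u δ ν * T ρ σ κ δ := by
  refine Finset.sum_congr rfl fun ρ _ => ?_
  symm
  refine (Finset.sum_eq_single β (fun σ _ h => ?_) (by simp)).trans ?_ <;> simp [*]

lemma perp_KN (g : Ten2 n) (ε : ℝ) (u : Vec n) {A B : Ten2 n}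
    (hA : IsSym2 A) (hB : IsSym2 B) (β ν : Fin n) :
    perp u (KN A B) β ν =
      s2perp u A * s2par g ε u B β ν + s2perp u B * s2par g ε u A β ν
        - (s2perppar g ε u A β * s2perppar g ε u B ν
           + s2perppar g ε u A ν * s2perppar g ε u B β) := by
  rw [perp_eq_sum_single, sum_mul_KN, bil_comm hA u (Pi.single ν 1),
    bil_comm hB u (Pi.single ν 1)]
  simp only [bil_single_left, contr_single, s2par_eq g ε u hA, s2par_eq g ε u hB, s2perppar_eq,
    ← s2perp_eq_bil]
  ring

lemma perppar_KN (g : Ten2 n) (ε : ℝ) (u : Vec n) {A B : Ten2 n}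
    (hA : IsSym2 A) (hB : IsSym2 B) (β μ ν : Fin n) :
    perppar g ε u (KN A B) β μ ν =
      (s2perppar g ε u A μ * s2par g ε u B ν β - s2perppar g ε u A ν * s2par g ε u B μ β)
      + (s2perppar g ε u B μ * s2par g ε u A ν β
         - s2perppar g ε u B ν * s2par g ε u A μ β) := by
  rw [perppar_eq_sum_single,
    sum_mul_KN u _ (fun κ => gamMix g ε u κ μ) (fun δ => gamMix g ε u δ ν),
    bil_comm hA u, bil_comm hA u, bil_comm hB u, bil_comm hB u]
  simp only [← s2perppar_eq_bil, bil_single_left, contr_gamMix, s2par_eq g ε u hA,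
    s2par_eq g ε u hB, hA β, hB β]
  simp only [s2perppar_eq]
  ring

lemma par4_KN (g : Ten2 n) (ε : ℝ) (u : Vec n) {A B : Ten2 n}
    (α β μ ν : Fin n) :
    par4 g ε u (KN A B) α β μ ν = KN (s2par g ε u A) (s2par g ε u B) α β μ ν :=
  sum_mul_KN (fun ρ => gamMix g ε u ρ α) (fun ρ => gamMix g ε u ρ β)
    (fun ρ => gamMix g ε u ρ μ) (fun ρ => gamMix g ε u ρ ν) A B

/-- Lemma `decom2`: decomposition of the Kulkarni–Nomizu product `A ∧ B`
with respect to `u`. -/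
theorem stmt3 {n : ℕ} (hn : 4 ≤ n) (g ginv : Ten2 n) (hg : GoodMetric g ginv)
    (ε : ℝ) (u : Vec n) (hu : UnitVec g ε u)
    (A B : Ten2 n) (hA : IsSym2 A) (hB : IsSym2 B) :
    (∀ β ν, perp u (KN A B) β ν =
        s2perp u A * s2par g ε u B β ν + s2perp u B * s2par g ε u A β ν
          - (s2perppar g ε u A β * s2perppar g ε u B ν
             + s2perppar g ε u A ν * s2perppar g ε u B β)) ∧
    (∀ β μ ν, perppar g ε u (KN A B) β μ ν =
        (s2perppar g ε u A μ * s2par g ε u B ν β - s2perppar g ε u A ν * s2par g ε u B μ β)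
        + (s2perppar g ε u B μ * s2par g ε u A ν β
           - s2perppar g ε u B ν * s2par g ε u A μ β)) ∧
    (∀ α β μ ν, parU g ε u (KN A B) α β μ ν =
        KN (s2par g ε u A) (s2par g ε u B) α β μ ν
        + (ε / ((n : ℝ) - 3)) * KN
            (fun β' ν' => s2perp u A * s2par g ε u B β' ν' + s2perp u B * s2par g ε u A β' ν'
              - (s2perppar g ε u A β' * s2perppar g ε u B ν'
                 + s2perppar g ε u A ν' * s2perppar g ε u B β'))
            (gam g ε u) α β μ ν) ∧
    (∀ α β μ ν, KN A B α β μ ν = parU g ε u (KN A B) α β μ ν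
        + ε * circ (lower g u) (perppar g ε u (KN A B)) α β μ ν
        + KN (perp u (KN A B)) (eta g ε u) α β μ ν) := by
  have hε : ε * ε = 1 := by rcases hu.1 with rfl | rfl <;> norm_num
  have hperp := funext₂ (perp_KN g ε u hA hB)
  refine ⟨perp_KN g ε u hA hB, perppar_KN g ε u hA hB, fun α β μ ν => ?_, fun α β μ ν => ?_⟩
  · rw [parU, par4_KN, hperp]
  · rw [parU, par4_KN, hperp]
    simp only [circ, perppar_KN g ε u hA hB]
    simp only [KN, eta]
    have decomp : ∀ {S : Ten2 n}, IsSym2 S → ∀ β ν, S β ν = s2par g ε u S β ν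
        + ε * (lower g u β * s2perppar g ε u S ν + lower g u ν * s2perppar g ε u S β)
        + s2perp u S * (lower g u β * lower g u ν) := fun hS β ν => by
      rw [s2par_eq g ε u hS, s2perppar_eq, s2perppar_eq]
      linear_combination (s2perp u _ * lower g u β * lower g u ν) * hε
    have hsym : ∀ {S : Ten2 n}, IsSym2 S → IsSym2 (s2par g ε u S) :=
      fun hS β ν => bil_comm hS _ _
    rw [decomp hA α μ, decomp hA α ν, decomp hA β μ, decomp hA β ν,
      decomp hB α μ, decomp hB α ν, decomp hB β μ, decomp hB β ν,
      hsym hA ν β, hsym hA μ β, hsym hA ν α, hsym hA μ α,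
      hsym hB ν β, hsym hB μ β, hsym hB ν α, hsym hB μ α]
    generalize s2par g ε u A = a, s2par g ε u B = b, s2perppar g ε u A = x,
      s2perppar g ε u B = y, lower g u = w
    linear_combination (w α * x μ * w ν * y β - w α * w μ * y ν * x β - w α * w μ * y β * x ν
      + w α * w ν * y μ * x β - x μ * w β * w ν * y α + w μ * x α * w β * y ν
      + w μ * w β * x ν * y α - x α * w β * w ν * y μ) * hε

end Decomp
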